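/- arXiv:2408.15600 — 5 statements merged into one kernel-verified Lean document; each statement's English description precedes it below -/
import Mathlib

section
/- Let E be a real inner product space, let N be a positive integer, and let u : Fin N → E, α : Fin N → ℝ, w : Fin N → ℝ, and κ ≥ 0 satisfy: α i > 0 for all i, ∑ i, α i = 1, ∑ i, w i = 1, and, setting g := ∑ i, α i • u i, the diversity bound ‖u i − g‖ ≤ κ for all i. Then ‖(∑ i, w i • u i) − g‖² ≤ (∑ i, (w i − α i)² / α i) * κ². -/
/-- Per-layer second-term bound in Lemma 2 of the paper. -/
theorem per_layer_weight_divergence_bound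
    {E : Type*} [NormedAddCommGroup E] [InnerProductSpace ℝ E]
    (N : ℕ) (hN : 0 < N) (u : Fin N → E) (α w : Fin N → ℝ) (κ : ℝ) (hκ : 0 ≤ κ)
    (hα : ∀ i, 0 < α i) (hαsum : ∑ i : Fin N, α i = 1)
    (hwsum : ∑ i : Fin N, w i = 1)
    (hdiv : ∀ i, ‖u i - ∑ j : Fin N, α j • u j‖ ≤ κ) :
    ‖(∑ i : Fin N, w i • u i) - ∑ j : Fin N, α j • u j‖ ^ 2
      ≤ (∑ i : Fin N, (w i - α i) ^ 2 / α i) * κ ^ 2 := by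
  set g := ∑ j : Fin N, α j • u j with hg
  have key : (∑ i, w i • u i) - g = ∑ i, (w i - α i) • (u i - g) := by
    simp only [smul_sub, sub_smul, Finset.sum_sub_distrib, ← Finset.sum_smul, hwsum, hαsum, ← hg]
    abel
  have hnorm : ‖(∑ i, w i • u i) - g‖ ≤ (∑ i, |w i - α i|) * κ := by
    rw [key, Finset.sum_mul]
    refine norm_sum_le_of_le _ fun i _ => ?_
    rw [norm_smul, Real.norm_eq_abs]
    exact mul_le_mul_of_nonneg_left (hdiv i) (abs_nonneg _)
  have hcs : (∑ i, |w i - α i|) ^ 2 ≤ ∑ i, (w i - α i) ^ 2 / α i := by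
    simpa [hαsum] using
      Finset.sq_sum_div_le_sum_sq_div Finset.univ (fun i => |w i - α i|) fun i _ => hα i
  calc ‖(∑ i, w i • u i) - g‖ ^ 2 ≤ ((∑ i, |w i - α i|) * κ) ^ 2 := by gcongr
    _ = (∑ i, |w i - α i|) ^ 2 * κ ^ 2 := mul_pow _ _ _
    _ ≤ (∑ i, (w i - α i) ^ 2 / α i) * κ ^ 2 := by gcongr
end

section
/- Model the L-layer parameter space as E := PiLp 2 (fun l : Fin L => EuclideanSpace ℝ (Fin (p l))), so that ‖x‖² = ∑ l, ‖x l‖² for x : E. Let N be a positive integer, let α : Fin N → ℝ with α i > 0 and ∑ i, α i = 1, let S : Finset (Fin L) be the set of selected layers, let w : Fin N → Fin L → ℝ satisfy ∑ i, w i l = 1 for every l ∈ S, let u : Fin N → (∀ l, EuclideanSpace ℝ (Fin (p l))) be the per-client layer gradients, set g l := ∑ i, α i • u i l, and let κ : Fin L → ℝ satisfy ‖g l − u i l‖ ≤ κ l for all i and l (gradient diversity). Define G : E by G l = g l, and D : E by D l = ∑ i, w i l • u i l if l ∈ S and D l = 0 otherwise. Then ‖G − D‖² ≤ 2 * (∑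 l ∉ S, ‖g l‖²) + 2 * ∑ l in S, (∑ i, (w i l − α i)² / α i) * (κ l)². -/
/-- The difference of two affine combinations of the same vectors is controlled by the chi-square
divergence of the weights and the radius of the vectors around any centre. -/
theorem norm_sum_smul_sub_sum_smul_sq_le {ι E : Type*} [Fintype ι]
    [SeminormedAddCommGroup E] [NormedSpace ℝ E] {a w : ι → ℝ} (ha : ∀ i, 0 < a i)
    (ha_sum : ∑ i, a i = 1) (hw_sum : ∑ i, w i = 1) {v : ι → E} {c : E} {r : ℝ}
    (hv : ∀ i, ‖c - v i‖ ≤ r) :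
    ‖∑ i, a i • v i - ∑ i, w i • v i‖ ^ 2 ≤ (∑ i, (w i - a i) ^ 2 / a i) * r ^ 2 := by
  have recenter : ∑ i, a i • v i - ∑ i, w i • v i = ∑ i, (w i - a i) • (c - v i) := by
    simp only [sub_smul, smul_sub, Finset.sum_sub_distrib, ← Finset.sum_smul, ha_sum, hw_sum]
    abel
  have norm_le : ‖∑ i, (w i - a i) • (c - v i)‖ ≤ (∑ i, |w i - a i|) * r := by
    rw [Finset.sum_mul]
    refine norm_sum_le_of_le _ fun i _ => ?_
    rw [norm_smul, Real.norm_eq_abs]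
    exact mul_le_mul_of_nonneg_left (hv i) (abs_nonneg _)
  have chi_sq := Finset.sq_sum_div_le_sum_sq_div Finset.univ (fun i => |w i - a i|)
    (fun i _ => ha i)
  simp only [ha_sum, div_one, sq_abs] at chi_sq
  rw [recenter]
  calc ‖∑ i, (w i - a i) • (c - v i)‖ ^ 2 ≤ ((∑ i, |w i - a i|) * r) ^ 2 := by gcongr
    _ = (∑ i, |w i - a i|) ^ 2 * r ^ 2 := mul_pow _ _ _
    _ ≤ _ := by gcongr

/-- Lemma 2 of the paper: the deviation between the full global gradient and the
aggregated underlying update is bounded by the gradient mass of unselected layers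
plus the heterogeneous-selection error. -/
theorem selective_layer_deviation_bound
    (L : ℕ) (p : Fin L → ℕ) (N : ℕ) (hN : 0 < N)
    (α : Fin N → ℝ) (hα : ∀ i, 0 < α i) (hαsum : ∑ i : Fin N, α i = 1)
    (S : Finset (Fin L)) (w : Fin N → Fin L → ℝ)
    (hw : ∀ l ∈ S, ∑ i : Fin N, w i l = 1)
    (u : Fin N → ∀ l : Fin L, EuclideanSpace ℝ (Fin (p l)))
    (g : ∀ l : Fin L, EuclideanSpace ℝ (Fin (p l)))
    (hg : ∀ l, g l = ∑ i : Fin N, α i • u i l)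
    (κ : Fin L → ℝ) (hκ : ∀ (i : Fin N) (l : Fin L), ‖g l - u i l‖ ≤ κ l)
    (G D : PiLp 2 (fun l : Fin L => EuclideanSpace ℝ (Fin (p l))))
    (hG : ∀ l, G l = g l)
    (hD : ∀ l, D l = if l ∈ S then ∑ i : Fin N, w i l • u i l else 0) :
    ‖G - D‖ ^ 2
      ≤ 2 * (∑ l ∈ Sᶜ, ‖g l‖ ^ 2)
        + 2 * ∑ l ∈ S, (∑ i : Fin N, (w i l - α i) ^ 2 / α i) * (κ l) ^ 2 := by
  have selected : ∑ l ∈ S, ‖(G - D) l‖ ^ 2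
      ≤ ∑ l ∈ S, (∑ i : Fin N, (w i l - α i) ^ 2 / α i) * (κ l) ^ 2 := by
    refine Finset.sum_le_sum fun l hl => ?_
    rw [PiLp.sub_apply, hG, hD, if_pos hl, hg]
    exact norm_sum_smul_sub_sum_smul_sq_le hα hαsum (hw l hl) fun i => hκ i l
  have unselected : ∑ l ∈ Sᶜ, ‖(G - D) l‖ ^ 2 = ∑ l ∈ Sᶜ, ‖g l‖ ^ 2 := by
    refine Finset.sum_congr rfl fun l hl => ?_
    rw [PiLp.sub_apply, hG, hD, if_neg (Finset.mem_compl.mp hl), sub_zero]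
  have unselected_nonneg : 0 ≤ ∑ l ∈ Sᶜ, ‖g l‖ ^ 2 := by positivity
  have selected_nonneg : 0 ≤ ∑ l ∈ S, ‖(G - D) l‖ ^ 2 := by positivity
  rw [PiLp.norm_sq_eq_of_L2, ← Finset.sum_add_sum_compl S]
  linarith
end

section
/- Let E be a real Hilbert space, γ > 0, and f : E → ℝ a differentiable function whose gradient is γ-Lipschitz: ‖gradient f x − gradient f y‖ ≤ γ * ‖x − y‖ for all x, y. Then for all θ, θ', h ∈ E: f θ' − f θ ≤ (1/(2γ)) * ‖gradient f θ − h‖² + ⟪h, θ' − θ⟫ + γ * ‖θ' − θ‖². -/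
open scoped RealInnerProductSpace

/-- **Descent lemma**: a differentiable function with `γ`-Lipschitz gradient lies below its
quadratic upper model at every point. -/
theorem sub_le_inner_gradient_add_of_lipschitz_gradient
    {E : Type*} [NormedAddCommGroup E] [InnerProductSpace ℝ E] [CompleteSpace E]
    {γ : ℝ} {f : E → ℝ} (hdiff : Differentiable ℝ f)
    (hlip : ∀ x y, ‖gradient f x - gradient f y‖ ≤ γ * ‖x - y‖) (x y : E) :
    f y - f x ≤ ⟪gradient f x, y - x⟫ + γ / 2 * ‖y - x‖ ^ 2 := by
  set v := y - x with hv
  have hline (t : ℝ) : HasDerivAt (fun s : ℝ => x + s • v) v t := by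
    simpa using ((hasDerivAt_id t).smul_const v).const_add x
  have hf (t : ℝ) : HasDerivAt (fun s : ℝ => f (x + s • v)) ⟪gradient f (x + t • v), v⟫ t := by
    simpa [Function.comp_def] using
      (hdiff (x + t • v)).hasGradientAt.hasFDerivAt.comp_hasDerivAt t (hline t)
  have hB (t : ℝ) : HasDerivAt
      (fun s : ℝ => f x + s * ⟪gradient f x, v⟫ + γ / 2 * ‖v‖ ^ 2 * s ^ 2)
      (⟪gradient f x, v⟫ + γ * ‖v‖ ^ 2 * t) t := by
    refine ((((hasDerivAt_id t).mul_const ⟪gradient f x, v⟫).const_add (f x)).add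
      ((hasDerivAt_pow 2 t).const_mul (γ / 2 * ‖v‖ ^ 2))).congr_deriv ?_
    norm_num
    ring
  have hbound (t : ℝ) (ht : 0 ≤ t) :
      ⟪gradient f (x + t • v), v⟫ ≤ ⟪gradient f x, v⟫ + γ * ‖v‖ ^ 2 * t := by
    have hgrad := hlip (x + t • v) x
    rw [add_sub_cancel_left, norm_smul, Real.norm_of_nonneg ht] at hgrad
    have hinner := real_inner_le_norm (gradient f (x + t • v) - gradient f x) v
    rw [inner_sub_left] at hinner
    nlinarith [mul_le_mul_of_nonneg_right hgrad (norm_nonneg v)]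
  have hle := image_le_of_deriv_right_le_deriv_boundary (a := 0) (b := 1)
    (fun t _ => (hf t).continuousAt.continuousWithinAt)
    (fun t _ => (hf t).hasDerivWithinAt) (by simp)
    (fun t _ => (hB t).continuousAt.continuousWithinAt)
    (fun t _ => (hB t).hasDerivWithinAt) (fun t ht => hbound t ht.1)
    (Set.right_mem_Icc.2 zero_le_one)
  simp only [one_smul, one_mul, one_pow, mul_one, hv, add_sub_cancel] at hle
  rw [hv]
  linarith

/-- Young's inequality for the inner product, with weight `γ`. -/
theorem real_inner_le_norm_sq_add_norm_sq
    {E : Type*} [NormedAddCommGroup E] [InnerProductSpace ℝ E]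
    {γ : ℝ} (hγ : 0 < γ) (u v : E) :
    ⟪u, v⟫ ≤ 1 / (2 * γ) * ‖u‖ ^ 2 + γ / 2 * ‖v‖ ^ 2 := by
  have hsq : 1 / (2 * γ) * ‖u‖ ^ 2 + γ / 2 * ‖v‖ ^ 2 - ‖u‖ * ‖v‖
      = (‖u‖ - γ * ‖v‖) ^ 2 / (2 * γ) := by
    field_simp
    ring
  have hnonneg : 0 ≤ (‖u‖ - γ * ‖v‖) ^ 2 / (2 * γ) := by positivity
  linarith [real_inner_le_norm u v]

/-- Deterministic form of Lemma 3 (one-round loss decay) of the paper. -/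
theorem one_round_loss_decay
    {E : Type*} [NormedAddCommGroup E] [InnerProductSpace ℝ E] [CompleteSpace E]
    (γ : ℝ) (hγ : 0 < γ) (f : E → ℝ) (hdiff : Differentiable ℝ f)
    (hlip : ∀ x y, ‖gradient f x - gradient f y‖ ≤ γ * ‖x - y‖)
    (θ θ' h : E) :
    f θ' - f θ ≤ (1 / (2 * γ)) * ‖gradient f θ - h‖ ^ 2
      + ⟪h, θ' - θ⟫ + γ * ‖θ' - θ‖ ^ 2 := by
  have hdescent := sub_le_inner_gradient_add_of_lipschitz_gradient hdiff hlip θ θ'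
  have hyoung := real_inner_le_norm_sq_add_norm_sq hγ (gradient f θ - h) (θ' - θ)
  rw [inner_sub_left] at hyoung
  linarith
end

section
/- Let E be a real Hilbert space, γ > 0, and f : E → ℝ a differentiable function whose gradient is γ-Lipschitz: ‖gradient f x − gradient f y‖ ≤ γ * ‖x − y‖ for all x, y. Let η > 0, σ ∈ ℝ, θ, h, Δ ∈ E with θ' := θ − η • Δ, and suppose ⟪h, Δ⟫ ≥ ‖h‖² and ‖Δ‖² ≤ ‖h‖² + σ². Then f θ' − f θ ≤ (1/(2γ)) * ‖gradient f θ − h‖² − η * (1 − γ*η) * ‖h‖² + γ * η² * σ². -/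
open scoped RealInnerProductSpace

/-- The quadratic upper bound for a function whose gradient is `γ`-Lipschitz. -/
theorem apply_add_le_of_gradient_lipschitz
    {E : Type*} [NormedAddCommGroup E] [InnerProductSpace ℝ E] [CompleteSpace E]
    {γ : ℝ} {f : E → ℝ} (hdiff : Differentiable ℝ f)
    (hlip : ∀ x y, ‖gradient f x - gradient f y‖ ≤ γ * ‖x - y‖) (x v : E) :
    f (x + v) ≤ f x + ⟪gradient f x, v⟫ + γ / 2 * ‖v‖ ^ 2 := by
  have hf (t : ℝ) : HasDerivAt (fun s : ℝ => f (x + s • v)) ⟪gradient f (x + t • v), v⟫ t := by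
    have hline : HasDerivAt (fun s : ℝ => x + s • v) v t := by
      simpa using ((hasDerivAt_id t).smul_const v).const_add x
    exact (hdiff (x + t • v)).hasGradientAt.hasFDerivAt.comp_hasDerivAt t hline
  have hB (t : ℝ) : HasDerivAt
      (fun s : ℝ => f x + s * ⟪gradient f x, v⟫ + γ / 2 * ‖v‖ ^ 2 * s ^ 2)
      (⟪gradient f x, v⟫ + γ * ‖v‖ ^ 2 * t) t := by
    refine ((((hasDerivAt_id t).mul_const ⟪gradient f x, v⟫).const_add (f x)).add
      ((hasDerivAt_pow 2 t).const_mul (γ / 2 * ‖v‖ ^ 2))).congr_deriv ?_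
    push_cast
    ring
  have hbound : ∀ t ∈ Set.Ico (0 : ℝ) 1,
      ⟪gradient f (x + t • v), v⟫ ≤ ⟪gradient f x, v⟫ + γ * ‖v‖ ^ 2 * t := by
    intro t ht
    have hgrad : ‖gradient f (x + t • v) - gradient f x‖ ≤ γ * (t * ‖v‖) := by
      simpa [norm_smul, abs_of_nonneg ht.1] using hlip (x + t • v) x
    have hinner := real_inner_le_norm (gradient f (x + t • v) - gradient f x) v
    rw [inner_sub_left] at hinner
    linarith [mul_le_mul_of_nonneg_right hgrad (norm_nonneg v)]
  simpa using image_le_of_deriv_right_le_deriv_boundary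
    (fun t _ => (hf t).continuousAt.continuousWithinAt) (fun t _ => (hf t).hasDerivWithinAt)
    (by simp) (fun t _ => (hB t).continuousAt.continuousWithinAt)
    (fun t _ => (hB t).hasDerivWithinAt) hbound (Set.right_mem_Icc.2 zero_le_one)

/-- Young's inequality for the inner product. -/
theorem neg_inner_le_norm_sq_add_norm_sq
    {E : Type*} [NormedAddCommGroup E] [InnerProductSpace ℝ E] {γ : ℝ} (hγ : 0 < γ) (u v : E) :
    -⟪u, v⟫ ≤ 1 / (2 * γ) * ‖u‖ ^ 2 + γ / 2 * ‖v‖ ^ 2 := by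
  have hsq : 0 ≤ 1 / (2 * γ) * ‖u + γ • v‖ ^ 2 := by positivity
  rw [norm_add_sq_real, real_inner_smul_right, norm_smul, Real.norm_of_nonneg hγ.le] at hsq
  have hexpand : 1 / (2 * γ) * (‖u‖ ^ 2 + 2 * (γ * ⟪u, v⟫) + (γ * ‖v‖) ^ 2) =
      1 / (2 * γ) * ‖u‖ ^ 2 + ⟪u, v⟫ + γ / 2 * ‖v‖ ^ 2 := by
    field_simp
  linarith

/-- Deterministic surrogate of the single-step per-round descent inequality
(equation (26)) in the proof of Theorem 1 of the paper. -/
theorem single_step_descent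
    {E : Type*} [NormedAddCommGroup E] [InnerProductSpace ℝ E] [CompleteSpace E]
    (γ : ℝ) (hγ : 0 < γ) (f : E → ℝ) (hdiff : Differentiable ℝ f)
    (hlip : ∀ x y, ‖gradient f x - gradient f y‖ ≤ γ * ‖x - y‖)
    (η : ℝ) (hη : 0 < η) (σ : ℝ) (θ h Δ : E) (θ' : E) (hθ' : θ' = θ - η • Δ)
    (hunbiased : ⟪h, Δ⟫ ≥ ‖h‖ ^ 2) (hvar : ‖Δ‖ ^ 2 ≤ ‖h‖ ^ 2 + σ ^ 2) :
    f θ' - f θ ≤ (1 / (2 * γ)) * ‖gradient f θ - h‖ ^ 2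
      - η * (1 - γ * η) * ‖h‖ ^ 2 + γ * η ^ 2 * σ ^ 2 := by
  subst hθ'
  have hdescent := apply_add_le_of_gradient_lipschitz hdiff hlip θ (-(η • Δ))
  have hyoung := neg_inner_le_norm_sq_add_norm_sq hγ (gradient f θ - h) (η • Δ)
  rw [← sub_eq_add_neg, inner_neg_right, norm_neg] at hdescent
  rw [inner_sub_left, real_inner_smul_right h] at hyoung
  have hnorm : ‖η • Δ‖ ^ 2 = η ^ 2 * ‖Δ‖ ^ 2 := by
    rw [norm_smul, mul_pow, Real.norm_eq_abs, sq_abs]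
  rw [hnorm] at hdescent hyoung
  linarith [mul_le_mul_of_nonneg_left hunbiased hη.le,
    mul_le_mul_of_nonneg_left hvar (by positivity : 0 ≤ γ * η ^ 2)]
end

section
/- Model the L-layer parameter space as E := PiLp 2 (fun l : Fin L => EuclideanSpace ℝ (Fin (p l))), so that ‖x‖² = ∑ l, ‖x l‖². Let N be a positive integer, let fi : Fin N → E → ℝ be differentiable local objectives, α : Fin N → ℝ with α i > 0 and ∑ i, α i = 1, and set f := fun x => ∑ i, α i * fi i x. Assume γ > 0 and the gradient of f is γ-Lipschitz: ‖gradient f x − gradient f y‖ ≤ γ * ‖x − y‖ for all x, y. Let η > 0 with C := 1 − γ*η > 0, and let fstar ∈ ℝ with f x ≥ fstar for all x. For each round t ∈ ℕ, let S t : Finset (Fin L) be the selected layers and w t : Fin N → Fin L → ℝ aggregation weights with ∑ i, w t i l = 1 for every l ∈ S t. Let κ : Fin L → ℝ. Define iterates θ : ℕ → E by θ (t+1) = θ t − η • D t, where (D t) l = ∑ i, w t i l • (gradient (fi i) (θ t)) l if l ∈ S t and (D t) l = 0 otherwise, and assume the gradient diversity bound ‖(gradient f (θ t)) l − (gradient (fi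 i) (θ t)) l‖ ≤ κ l for all t, i, l. Then for every T ≥ 1 there exists t < T with ‖gradient f (θ t)‖² ≤ (2/(η*C*T)) * (f (θ 0) − fstar) + (1/T) * ∑_{t<T} (1/(γ*η*C) + 2) * (2 * (∑ l ∉ S t, ‖(gradient f (θ t)) l‖²) + 2 * ∑ l in S t, (∑ i, (w t i l − α i)² / α i) * (κ l)²). -/
/-- Quadratic upper bound for a function with Lipschitz gradient. -/
theorem le_add_inner_gradient_add_sq {E : Type*} [NormedAddCommGroup E] [InnerProductSpace ℝ E]
    [CompleteSpace E] {f : E → ℝ} (hf : Differentiable ℝ f) {γ : ℝ}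
    (hlip : ∀ x y, ‖gradient f x - gradient f y‖ ≤ γ * ‖x - y‖) (x v : E) :
    f (x + v) ≤ f x + inner ℝ (gradient f x) v + γ / 2 * ‖v‖ ^ 2 := by
  set φ : ℝ → ℝ := fun s => f (x + s • v) - s * inner ℝ (gradient f x) v - s ^ 2 * (γ / 2 * ‖v‖ ^ 2)
  have hφ (s : ℝ) : HasDerivAt φ (inner ℝ (gradient f (x + s • v)) v - inner ℝ (gradient f x) v
      - 2 * s * (γ / 2 * ‖v‖ ^ 2)) s := by
    have hline : HasDerivAt (fun s : ℝ => x + s • v) v s := by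
      simpa using ((hasDerivAt_id s).smul_const v).const_add x
    have hcomp := (hf (x + s • v)).hasFDerivAt.comp_hasDerivAt s hline
    rw [← inner_gradient_left] at hcomp
    have hlin := (hasDerivAt_id s).mul_const (inner ℝ (gradient f x) v)
    have hsq := (hasDerivAt_pow 2 s).mul_const (γ / 2 * ‖v‖ ^ 2)
    refine ((hcomp.sub hlin).sub hsq).congr_deriv ?_
    simp
  have hanti : AntitoneOn φ (Set.Icc 0 1) := by
    refine antitoneOn_of_deriv_nonpos (convex_Icc 0 1)
      (fun s _ => (hφ s).continuousAt.continuousWithinAt)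
      (fun s _ => (hφ s).differentiableAt.differentiableWithinAt) fun s hs => ?_
    rw [interior_Icc] at hs
    rw [(hφ s).deriv, ← inner_sub_left]
    have hgrad : ‖gradient f (x + s • v) - gradient f x‖ ≤ γ * (s * ‖v‖) := by
      simpa [norm_smul, abs_of_pos hs.1] using hlip (x + s • v) x
    nlinarith [real_inner_le_norm (gradient f (x + s • v) - gradient f x) v,
      mul_le_mul_of_nonneg_right hgrad (norm_nonneg v)]
  have h := hanti (Set.left_mem_Icc.2 zero_le_one) (Set.right_mem_Icc.2 zero_le_one) zero_le_one
  simp only [φ, one_smul, zero_smul, add_zero] at h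
  linarith

/-- One step of inexact gradient descent, with step size at most the inverse smoothness constant. -/
theorem norm_gradient_sq_le_of_inexact_step {E : Type*} [NormedAddCommGroup E]
    [InnerProductSpace ℝ E] [CompleteSpace E] {f : E → ℝ} (hf : Differentiable ℝ f) {γ η : ℝ}
    (hlip : ∀ x y, ‖gradient f x - gradient f y‖ ≤ γ * ‖x - y‖) (hη : 0 < η) (hγη : γ * η ≤ 1)
    (x d : E) :
    ‖gradient f x‖ ^ 2 ≤ 2 / η * (f x - f (x - η • d)) + ‖gradient f x - d‖ ^ 2 := by
  have h := le_add_inner_gradient_add_sq hf hlip x (-(η • d))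
  rw [← sub_eq_add_neg, inner_neg_right, inner_smul_right, norm_neg, norm_smul, mul_pow,
    Real.norm_eq_abs, sq_abs] at h
  have hexp := norm_sub_sq_real (gradient f x) d
  have hd : η * (γ * η) * ‖d‖ ^ 2 ≤ η * ‖d‖ ^ 2 := by
    have := mul_le_mul_of_nonneg_left hγη hη.le
    nlinarith [sq_nonneg ‖d‖]
  have hkey : η * (‖gradient f x‖ ^ 2 - ‖gradient f x - d‖ ^ 2) ≤ 2 * (f x - f (x - η • d)) := by
    rw [hexp]
    linarith
  rw [← sub_le_iff_le_add, div_mul_eq_mul_div, le_div_iff₀ hη]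
  linarith

/-- Replacing the weights `α` by `w` in a weighted average of vectors within distance `κ` of their
`α`-mean moves the average by at most `κ` times the square root of the `χ²`-divergence. -/
theorem norm_sub_weighted_sum_sq_le {ι V : Type*} [Fintype ι] [NormedAddCommGroup V]
    [NormedSpace ℝ V] {α w : ι → ℝ} (hα : ∀ i, 0 < α i) (hαsum : ∑ i, α i = 1)
    (hw : ∑ i, w i = 1) {g : ι → V} {m : V} (hm : m = ∑ i, α i • g i) {κ : ℝ}
    (hκ : ∀ i, ‖m - g i‖ ≤ κ) :
    ‖m - ∑ i, w i • g i‖ ^ 2 ≤ (∑ i, (w i - α i) ^ 2 / α i) * κ ^ 2 := by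
  have heq : m - ∑ i, w i • g i = ∑ i, (w i - α i) • (m - g i) := by
    simp only [smul_sub, sub_smul, Finset.sum_sub_distrib, ← Finset.sum_smul, hw, hαsum, ← hm]
    abel
  have hnorm : ‖m - ∑ i, w i • g i‖ ≤ (∑ i, |w i - α i|) * κ := by
    rw [heq, Finset.sum_mul]
    refine (norm_sum_le _ _).trans (Finset.sum_le_sum fun i _ => ?_)
    rw [norm_smul, Real.norm_eq_abs]
    exact mul_le_mul_of_nonneg_left (hκ i) (abs_nonneg _)
  have hchi := Finset.sq_sum_div_le_sum_sq_div Finset.univ (fun i => |w i - α i|)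
    (fun i _ => hα i)
  simp only [hαsum, div_one, sq_abs] at hchi
  calc ‖m - ∑ i, w i • g i‖ ^ 2 ≤ ((∑ i, |w i - α i|) * κ) ^ 2 :=
        pow_le_pow_left₀ (norm_nonneg _) hnorm 2
    _ = (∑ i, |w i - α i|) ^ 2 * κ ^ 2 := mul_pow _ _ _
    _ ≤ _ := mul_le_mul_of_nonneg_right hchi (sq_nonneg κ)

theorem gradient_weighted_sum {E ι : Type*} [NormedAddCommGroup E] [InnerProductSpace ℝ E]
    [CompleteSpace E] [Fintype ι] {F : ι → E → ℝ} (hF : ∀ i, Differentiable ℝ (F i))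
    (α : ι → ℝ) (x : E) :
    gradient (fun y => ∑ i, α i * F i y) x = ∑ i, α i • gradient (F i) x := by
  apply HasGradientAt.gradient
  rw [hasGradientAt_iff_hasFDerivAt, map_sum]
  refine HasFDerivAt.fun_sum fun i _ => ?_
  rw [map_smul, toDual_gradient]
  exact (hF i x).hasFDerivAt.const_mul (α i)

/-- The aggregated direction differs from the gradient by the mass of the unselected layers and
the heterogeneous-selection error. -/
theorem norm_sub_selected_sq_le {ι Λ : Type*} [Fintype ι] [Fintype Λ] [DecidableEq Λ]
    {V : Λ → Type*} [∀ l, NormedAddCommGroup (V l)] [∀ l, NormedSpace ℝ (V l)]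
    {α : ι → ℝ} (hα : ∀ i, 0 < α i) (hαsum : ∑ i, α i = 1) {S : Finset Λ} {w : ι → Λ → ℝ}
    (hw : ∀ l ∈ S, ∑ i, w i l = 1) {g : ι → PiLp 2 V} {m d : PiLp 2 V}
    (hm : m = ∑ i, α i • g i) (hd : ∀ l, d l = if l ∈ S then ∑ i, w i l • g i l else 0)
    {κ : Λ → ℝ} (hκ : ∀ i l, ‖m l - g i l‖ ≤ κ l) :
    ‖m - d‖ ^ 2 ≤ ∑ l ∈ Sᶜ, ‖m l‖ ^ 2
      + ∑ l ∈ S, (∑ i, (w i l - α i) ^ 2 / α i) * κ l ^ 2 := by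
  rw [PiLp.norm_sq_eq_of_L2, ← Finset.sum_compl_add_sum S]
  refine add_le_add (Finset.sum_le_sum fun l hl => ?_) (Finset.sum_le_sum fun l hl => ?_)
  · rw [PiLp.sub_apply, hd, if_neg (Finset.mem_compl.1 hl), sub_zero]
  · rw [PiLp.sub_apply, hd, if_pos hl]
    exact norm_sub_weighted_sum_sq_le hα hαsum (hw l hl)
      (by simp [hm]) fun i => hκ i l


/-- Theorem 1 combined with Lemma 2 of the paper, for the exact-gradient
(full-batch, σ = 0, τ = 1) instance of federated selective layer fine-tuning. -/
theorem selective_layer_finetuning_full_bound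
    (L : ℕ) (p : Fin L → ℕ) (N : ℕ) (hN : 0 < N)
    (fi : Fin N → PiLp 2 (fun l : Fin L => EuclideanSpace ℝ (Fin (p l))) → ℝ)
    (hfi : ∀ i, Differentiable ℝ (fi i))
    (α : Fin N → ℝ) (hα : ∀ i, 0 < α i) (hαsum : ∑ i : Fin N, α i = 1)
    (f : PiLp 2 (fun l : Fin L => EuclideanSpace ℝ (Fin (p l))) → ℝ)
    (hf : f = fun x => ∑ i : Fin N, α i * fi i x)
    (γ : ℝ) (hγ : 0 < γ)
    (hlip : ∀ x y, ‖gradient f x - gradient f y‖ ≤ γ * ‖x - y‖)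
    (η : ℝ) (hη : 0 < η) (C : ℝ) (hC : C = 1 - γ * η) (hCpos : 0 < C)
    (fstar : ℝ) (hfstar : ∀ x, f x ≥ fstar)
    (S : ℕ → Finset (Fin L)) (w : ℕ → Fin N → Fin L → ℝ)
    (hw : ∀ t, ∀ l ∈ S t, ∑ i : Fin N, w t i l = 1)
    (κ : Fin L → ℝ)
    (θ D : ℕ → PiLp 2 (fun l : Fin L => EuclideanSpace ℝ (Fin (p l))))
    (hD : ∀ t l, D t l =
      if l ∈ S t then ∑ i : Fin N, w t i l • gradient (fi i) (θ t) l else 0)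
    (hstep : ∀ t, θ (t + 1) = θ t - η • D t)
    (hdiv : ∀ (t : ℕ) (i : Fin N) (l : Fin L),
      ‖gradient f (θ t) l - gradient (fi i) (θ t) l‖ ≤ κ l) :
    ∀ T : ℕ, 1 ≤ T → ∃ t < T,
      ‖gradient f (θ t)‖ ^ 2
        ≤ (2 / (η * C * T)) * (f (θ 0) - fstar)
          + (1 / T) * ∑ t ∈ Finset.range T, (1 / (γ * η * C) + 2) *
              (2 * (∑ l ∈ (S t)ᶜ, ‖gradient f (θ t) l‖ ^ 2)
                + 2 * ∑ l ∈ S t,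
                    (∑ i : Fin N, (w t i l - α i) ^ 2 / α i) * (κ l) ^ 2) := by
  have hfd : Differentiable ℝ f := by
    rw [hf]
    exact Differentiable.fun_sum fun i _ => (hfi i).const_mul (α i)
  have hgrad (x) : gradient f x = ∑ i, α i • gradient (fi i) x := by
    rw [hf]
    exact gradient_weighted_sum hfi α x
  have hγη : 0 < γ * η := mul_pos hγ hη
  have hC1 : C ≤ 1 := by linarith
  intro T hT
  have hTpos : (0 : ℝ) < T := by exact_mod_cast hT
  set R : ℕ → ℝ := fun t => (1 / (γ * η * C) + 2) *
    (2 * (∑ l ∈ (S t)ᶜ, ‖gradient f (θ t) l‖ ^ 2)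
      + 2 * ∑ l ∈ S t, (∑ i : Fin N, (w t i l - α i) ^ 2 / α i) * (κ l) ^ 2) with hR
  have hround (t : ℕ) :
      ‖gradient f (θ t)‖ ^ 2 ≤ 2 / η * (f (θ t) - f (θ (t + 1))) + R t := by
    have hdesc := norm_gradient_sq_le_of_inexact_step hfd hlip hη (by linarith) (θ t) (D t)
    have herr := norm_sub_selected_sq_le hα hαsum (hw t) (hgrad (θ t)) (hD t) (hdiv t)
    rw [← hstep] at hdesc
    have hpos : 0 < 1 / (γ * η * C) := by positivity
    have hle := (sq_nonneg _).trans herr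
    simp only [hR]
    nlinarith [mul_nonneg hpos.le hle]
  by_contra! hcon
  have hsum := Finset.sum_le_sum fun t (_ : t ∈ Finset.range T) => hround t
  rw [Finset.sum_add_distrib, ← Finset.mul_sum, Finset.sum_range_sub' (fun t => f (θ t))] at hsum
  have hlt := Finset.sum_lt_sum_of_nonempty (Finset.nonempty_range_iff.2 (by omega))
    fun t ht => hcon t (Finset.mem_range.1 ht)
  rw [Finset.sum_const, Finset.card_range, nsmul_eq_mul] at hlt
  have hcoef : 2 / η ≤ 2 / (η * C) :=
    div_le_div_of_nonneg_left zero_le_two (by positivity) (mul_le_of_le_one_right hη.le hC1)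
  have hgap : 2 / η * (f (θ 0) - f (θ T)) ≤ 2 / (η * C) * (f (θ 0) - fstar) := by
    have h0 := hfstar (θ 0)
    calc 2 / η * (f (θ 0) - f (θ T)) ≤ 2 / η * (f (θ 0) - fstar) :=
          mul_le_mul_of_nonneg_left (by linarith [hfstar (θ T)]) (by positivity)
      _ ≤ _ := mul_le_mul_of_nonneg_right hcoef (by linarith)
  have hscale : (T : ℝ) * (2 / (η * C * T) * (f (θ 0) - fstar)
      + 1 / T * ∑ t ∈ Finset.range T, R t)
      = 2 / (η * C) * (f (θ 0) - fstar) + ∑ t ∈ Finset.range T, R t := by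
    field_simp
  linarith
end
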